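/- For every ε ∈ (0,1] there exists μ > 0 such that for all integers t, r ≥ 2 there exists s ∈ ℕ with the following property: if 𝒜 is an ε-wicked reduced hypergraph with index set I, J ⊆ I has size at least s, and Φ₁,…,Φ_r are (μ, 1/3+ε)-holes on J, then there exists a subset J⋆ ⊆ J of size t such that (i) for all ρ, ρ' ∈ [r] the holes Φ_ρ and Φ_{ρ'} are either ε-intersecting or ε-disjoint on J⋆, and (ii) the relation ≡_{ε,J⋆} is an equivalence relation on {Φ₁,…,Φ_r} with at most two equivalence classes. -/

import Mathlib

open Finset Classical

noncomputable section

/-- A reduced hypergraph: a finite (linearly ordered, here `ℕ`) index set `I`,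
pairwise disjoint nonempty finite vertex classes `P i j` for distinct `i j ∈ I`,
and for each triple of distinct indices a tripartite 3-uniform constituent,
encoded by a symmetric edge predicate on vertices. -/
structure ReducedHG where
  I : Finset ℕ
  P : ℕ → ℕ → Finset ℕ
  Psymm : ∀ i j, P i j = P j i
  Pnonempty : ∀ i j, i ∈ I → j ∈ I → i ≠ j → (P i j).Nonempty
  Pdisjoint : ∀ i j k l, i ≠ j → k ≠ l → ({i, j} : Finset ℕ) ≠ ({k, l} : Finset ℕ) →
      Disjoint (P i j) (P k l)
  Edge : ℕ → ℕ → ℕ → Prop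
  EdgeSymm : ∀ a b c, Edge a b c → Edge b a c
  EdgeSymm' : ∀ a b c, Edge a b c → Edge a c b
  EdgeValid : ∀ a b c, Edge a b c → ∃ i j k, i ∈ I ∧ j ∈ I ∧ k ∈ I ∧
      i ≠ j ∧ i ≠ k ∧ j ≠ k ∧ a ∈ P i j ∧ b ∈ P i k ∧ c ∈ P j k

namespace ReducedHG

variable (A : ReducedHG)

/-- The neighbourhood, inside the vertex class `P j k`, of two vertices `a`, `b`. -/
def nbhd (j k : ℕ) (a b : ℕ) : Finset ℕ := (A.P j k).filter fun c => A.Edge a b c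

/-- The number of crossing edges between three vertex sets. -/
def ecount (X Y Z : Finset ℕ) : ℕ :=
  ((X ×ˢ Y ×ˢ Z).filter fun t => A.Edge t.1 t.2.1 t.2.2).card

/-- `(d, ee)`-density: every pair of vertices sharing an index has large degree. -/
def EEDense (d : ℝ) : Prop :=
  ∀ i j k, i ∈ A.I → j ∈ A.I → k ∈ A.I → i ≠ j → i ≠ k → j ≠ k →
    ∀ a ∈ A.P i j, ∀ b ∈ A.P i k,
      d * ((A.P j k).card : ℝ) ≤ ((A.nbhd j k a b).card : ℝ)

/-- `(μ, vvv)`-density: every constituent has many edges. -/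
def VVVDense (μ : ℝ) : Prop :=
  ∀ i j k, i ∈ A.I → j ∈ A.I → k ∈ A.I → i ≠ j → i ≠ k → j ≠ k →
    μ * (((A.P i j).card : ℝ) * ((A.P i k).card : ℝ) * ((A.P j k).card : ℝ)) ≤
      (A.ecount (A.P i j) (A.P i k) (A.P j k) : ℝ)

/-- The reduced hypergraph supports a `K₅⁽³⁾`. -/
def SupportsK5 : Prop :=
  ∃ J ⊆ A.I, J.card = 5 ∧ ∃ f : ℕ → ℕ → ℕ,
    (∀ i ∈ J, ∀ j ∈ J, f i j = f j i) ∧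
    (∀ i ∈ J, ∀ j ∈ J, i ≠ j → f i j ∈ A.P i j) ∧
    (∀ i ∈ J, ∀ j ∈ J, ∀ k ∈ J, i ≠ j → i ≠ k → j ≠ k →
      A.Edge (f i j) (f i k) (f j k))

/-- `ε`-wicked: `(1/3 + ε, ee)`-dense and not supporting a `K₅⁽³⁾`. -/
def Wicked (ε : ℝ) : Prop := A.EEDense (1/3 + ε) ∧ ¬ A.SupportsK5

/-- A `J`-transversal: one vertex in each class `P i j`, `ij ∈ J⁽²⁾`. -/
def IsTransversal (J : Finset ℕ) (Q : ℕ → ℕ → ℕ) : Prop :=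
  (∀ i ∈ J, ∀ j ∈ J, Q i j = Q j i) ∧ ∀ i ∈ J, ∀ j ∈ J, i ≠ j → Q i j ∈ A.P i j

/-- A `(K, L)`-transversal: one vertex in each class `P k l`, `(k, l) ∈ K × L`. -/
def IsTransversal2 (K L : Finset ℕ) (Q : ℕ → ℕ → ℕ) : Prop :=
  ∀ k ∈ K, ∀ l ∈ L, Q k l ∈ A.P k l

/-- An inhabited triple of `J`-transversals. -/
def InhabitedTriple (J : Finset ℕ) (Q R S : ℕ → ℕ → ℕ) : Prop :=
  ∀ i ∈ J, ∀ j ∈ J, ∀ k ∈ J, i < j → j < k → A.Edge (Q i j) (R i k) (S j k)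

/-- An inhabited triple consisting of a `(K,L)`-, a `(K,M)`- and an `(L,M)`-transversal. -/
def InhabitedTriple2 (K L M : Finset ℕ) (Q R S : ℕ → ℕ → ℕ) : Prop :=
  ∀ k ∈ K, ∀ l ∈ L, ∀ m ∈ M, A.Edge (Q k l) (R k m) (S l m)

/-- `Φ` is a `μ`-hole on `J`. -/
def IsHole (μ : ℝ) (J : Finset ℕ) (Φ : Finset ℕ) : Prop :=
  (∀ i ∈ J, ∀ j ∈ J, i ≠ j → (Φ ∩ A.P i j).Nonempty) ∧
  ∀ i ∈ J, ∀ j ∈ J, ∀ k ∈ J, i ≠ j → i ≠ k → j ≠ k →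
    (A.ecount (Φ ∩ A.P i j) (Φ ∩ A.P i k) (Φ ∩ A.P j k) : ℝ) ≤
      μ * (((A.P i j).card : ℝ) * ((A.P i k).card : ℝ) * ((A.P j k).card : ℝ))

/-- `Φ` is a `(μ, ϑ)`-hole on `J` (a `μ`-hole of width at least `ϑ`). -/
def IsHoleW (μ ϑ : ℝ) (J : Finset ℕ) (Φ : Finset ℕ) : Prop :=
  A.IsHole μ J Φ ∧ ∀ i ∈ J, ∀ j ∈ J, i ≠ j →
    ϑ * ((A.P i j).card : ℝ) ≤ (((Φ ∩ A.P i j)).card : ℝ)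

/-- Two holes are `ε`-intersecting on `J`. -/
def HolesIntersecting (ε : ℝ) (J : Finset ℕ) (Φ Ψ : Finset ℕ) : Prop :=
  ∀ i ∈ J, ∀ j ∈ J, i ≠ j →
    ε * ((A.P i j).card : ℝ) ≤ ((Φ ∩ Ψ ∩ A.P i j).card : ℝ)

/-- Two holes are `ε`-disjoint on `J`. -/
def HolesDisjoint (ε : ℝ) (J : Finset ℕ) (Φ Ψ : Finset ℕ) : Prop :=
  ∀ i ∈ J, ∀ j ∈ J, i ≠ j →
    ((Φ ∩ Ψ ∩ A.P i j).card : ℝ) < ε * ((A.P i j).card : ℝ)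

/-- The link on `K` of the family `k ↦ f k`, where `f k` is a vertex in a class `P k ·`:
`⋃_{k ≠ k' ∈ K} N(f k, f k')`. -/
def link (K : Finset ℕ) (f : ℕ → ℕ) : Finset ℕ :=
  ((K ×ˢ K).filter fun p => p.1 ≠ p.2).biUnion fun p => A.nbhd p.1 p.2 (f p.1) (f p.2)

/-- The pair consisting of a transversal `T` on `Sh × B` and a transversal `U` on `Sh × C`
has `δ`-intersecting links. -/
def IntersectingLinks (δ : ℝ) (Sh B C : Finset ℕ) (T U : ℕ → ℕ → ℕ) : Prop :=
  ∀ a ∈ Sh, ∀ a' ∈ Sh, a ≠ a' → ∀ b ∈ B, ∀ c ∈ C,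
    δ * ((A.P a a').card : ℝ) ≤
      (((A.nbhd a a' (T a b) (T a' b)) ∩ (A.nbhd a a' (U a c) (U a' c))).card : ℝ)

/-- The pair consisting of a transversal `T` on `Sh × B` and a transversal `U` on `Sh × C`
has `δ`-disjoint links. -/
def DisjointLinks (δ : ℝ) (Sh B C : Finset ℕ) (T U : ℕ → ℕ → ℕ) : Prop :=
  ∀ a ∈ Sh, ∀ a' ∈ Sh, a ≠ a' → ∀ b ∈ B, ∀ c ∈ C,
    (((A.nbhd a a' (T a b) (T a' b)) ∩ (A.nbhd a a' (U a c) (U a' c))).card : ℝ) <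
      δ * ((A.P a a').card : ℝ)

/-- A bicolouring of the reduced hypergraph: both colours appear in every vertex class and
no edge is monochromatic. -/
def IsBicolouring (φ : ℕ → Bool) : Prop :=
  (∀ i ∈ A.I, ∀ j ∈ A.I, i ≠ j →
    (∃ v ∈ A.P i j, φ v = true) ∧ (∃ v ∈ A.P i j, φ v = false)) ∧
  ∀ a b c, A.Edge a b c → ¬ (φ a = φ b ∧ φ b = φ c)

/-- The minimum monochromatic codegree density is at least `x`: `τ₂(A, φ) ≥ x`. -/
def Tau2Ge (φ : ℕ → Bool) (x : ℝ) : Prop :=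
  ∀ i j k, i ∈ A.I → j ∈ A.I → k ∈ A.I → i ≠ j → i ≠ k → j ≠ k →
    ∀ a ∈ A.P i j, ∀ b ∈ A.P i k, φ a = φ b →
      x * ((A.P j k).card : ℝ) ≤ ((A.nbhd j k a b).card : ℝ)

/-- The `γ`-bad left cherries (both vertices in one hole, many neighbours outside
the other hole). -/
def badLeft (Φ Ψ : Finset ℕ) (γ : ℝ) (i j k : ℕ) : Finset (ℕ × ℕ) :=
  (A.P i j ×ˢ A.P i k).filter fun p =>
    (p.1 ∈ Φ ∧ p.2 ∈ Φ ∧ γ * ((A.P j k).card : ℝ) ≤ (((A.nbhd j k p.1 p.2) \ Ψ).card : ℝ)) ∨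
    (p.1 ∈ Ψ ∧ p.2 ∈ Ψ ∧ γ * ((A.P j k).card : ℝ) ≤ (((A.nbhd j k p.1 p.2) \ Φ).card : ℝ))

/-- The `γ`-bad middle cherries. -/
def badMid (Φ Ψ : Finset ℕ) (γ : ℝ) (i j k : ℕ) : Finset (ℕ × ℕ) :=
  (A.P i j ×ˢ A.P j k).filter fun p =>
    (p.1 ∈ Φ ∧ p.2 ∈ Φ ∧ γ * ((A.P i k).card : ℝ) ≤ (((A.nbhd i k p.1 p.2) \ Ψ).card : ℝ)) ∨
    (p.1 ∈ Ψ ∧ p.2 ∈ Ψ ∧ γ * ((A.P i k).card : ℝ) ≤ (((A.nbhd i k p.1 p.2) \ Φ).card : ℝ))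

/-- The `γ`-bad right cherries. -/
def badRight (Φ Ψ : Finset ℕ) (γ : ℝ) (i j k : ℕ) : Finset (ℕ × ℕ) :=
  (A.P i k ×ˢ A.P j k).filter fun p =>
    (p.1 ∈ Φ ∧ p.2 ∈ Φ ∧ γ * ((A.P i j).card : ℝ) ≤ (((A.nbhd i j p.1 p.2) \ Ψ).card : ℝ)) ∨
    (p.1 ∈ Ψ ∧ p.2 ∈ Ψ ∧ γ * ((A.P i j).card : ℝ) ≤ (((A.nbhd i j p.1 p.2) \ Φ).card : ℝ))

end ReducedHG

section Helpers

theorem aux_pigeon {α C : Type*} [Fintype C] (J : Finset α) (d : α → C) (m : ℕ)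
    (h : Fintype.card C * m < J.card) : ∃ col : C, ∃ J' ⊆ J, m < J'.card ∧ ∀ i ∈ J', d i = col := by
  obtain ⟨col, -, hc⟩ := Finset.exists_lt_card_fiber_of_mul_lt_card_of_maps_to
    (s := J) (t := (Finset.univ : Finset C)) (f := d) (n := m) (fun _ _ => Finset.mem_univ _)
    (by simpa using h)
  exact ⟨col, _, Finset.filter_subset _ _, hc, fun i hi => (Finset.mem_filter.1 hi).2⟩

theorem aux_endhom (C : Type) [Fintype C] (n : ℕ) : ∃ N : ℕ, ∀ {α : Type} [LinearOrder α]
    (J : Finset α) (c : α → α → C), N ≤ J.card → ∃ J' ⊆ J, J'.card = n ∧ ∃ d : α → C,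
      ∀ i ∈ J', ∀ j ∈ J', i < j → c i j = d i := by
  induction n with
  | zero =>
    refine ⟨1, fun {α} _ J c hJ => ⟨∅, by simp, by simp, ?_⟩⟩
    obtain ⟨a, -⟩ := Finset.card_pos.1 hJ
    exact ⟨fun i => c a a, by simp⟩
  | succ n ih =>
    obtain ⟨N, hN⟩ := ih
    refine ⟨Fintype.card C * N + 2, fun {α} _ J c hJ => ?_⟩
    have hne : J.Nonempty := Finset.card_pos.1 (by omega)
    set a := J.min' hne with ha
    have haJ : a ∈ J := J.min'_mem hne
    obtain ⟨col, K, hKJ, hKc, hK⟩ := aux_pigeon (J.erase a) (c a) N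
      (by rw [Finset.card_erase_of_mem haJ]; omega)
    obtain ⟨J', hJ'K, hJ'c, d, hd⟩ := hN K c hKc.le
    have hlt : ∀ j ∈ J', a < j := fun j hj => by
      have := hKJ (hJ'K hj)
      exact lt_of_le_of_ne (J.min'_le _ (Finset.mem_of_mem_erase this))
        (Finset.ne_of_mem_erase this).symm
    have haJ' : a ∉ J' := fun h => lt_irrefl _ (hlt a h)
    refine ⟨insert a J', ?_, by rw [Finset.card_insert_of_notMem haJ', hJ'c],
      fun i => if i = a then col else d i, ?_⟩
    · intro i hi
      rcases Finset.mem_insert.1 hi with rfl | hi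
      · exact haJ
      · exact Finset.mem_of_mem_erase (hKJ (hJ'K hi))
    · intro i hi j hj hij
      rcases Finset.mem_insert.1 hi with hia | hi
      · rcases Finset.mem_insert.1 hj with hja | hj
        · exact absurd hij (by rw [hia, hja]; exact lt_irrefl _)
        · simp only [hia, if_true]
          exact hK j (hJ'K hj)
      · rcases Finset.mem_insert.1 hj with hja | hj
        · exact absurd hij (by rw [hja]; exact (hlt i hi).not_gt)
        · simp only [if_neg (hlt i hi).ne']
          exact hd i hi j hj hij

theorem aux_ramsey (C : Type) [Fintype C] (m : ℕ) : ∃ N : ℕ, ∀ {α : Type} [LinearOrder α]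
    (J : Finset α) (c : α → α → C), N ≤ J.card → ∃ J' ⊆ J, J'.card = m ∧ ∃ col : C,
      ∀ i ∈ J', ∀ j ∈ J', i < j → c i j = col := by
  obtain ⟨N, hN⟩ := aux_endhom C (Fintype.card C * m + 1)
  refine ⟨N, fun {α} _ J c hJ => ?_⟩
  obtain ⟨K, hKJ, hKc, d, hd⟩ := hN J c hJ
  obtain ⟨col, K', hK'K, hK'c, hK'⟩ := aux_pigeon K d m (by omega)
  obtain ⟨J', hJ'K', hJ'⟩ := Finset.exists_subset_card_eq hK'c.le
  refine ⟨J', (hJ'K'.trans hK'K).trans hKJ, hJ', col, fun i hi j hj hij => ?_⟩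
  rw [hd i (hK'K (hJ'K' hi)) j (hK'K (hJ'K' hj)) hij, hK' i (hJ'K' hi)]

theorem aux_avg {ι : Type} [Fintype ι] [DecidableEq ι] (V : ι → Finset ℕ) (i : ι)
    (f : (ι → ℕ) → ℝ) :
    ((V i).card : ℝ) * ∑ ω ∈ Fintype.piFinset V, f ω
      = ∑ ω ∈ Fintype.piFinset V, ∑ a ∈ V i, f (Function.update ω i a) := by
  have h1 : ((V i).card : ℝ) * ∑ ω ∈ Fintype.piFinset V, f ω
      = ∑ p ∈ Fintype.piFinset V ×ˢ V i, f p.1 := by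
    rw [Finset.sum_product, Finset.mul_sum]
    exact Finset.sum_congr rfl fun ω _ => by simp
  rw [h1, ← Finset.sum_product' (Fintype.piFinset V) (V i) fun ω a => f (Function.update ω i a)]
  have key : ∀ p ∈ Fintype.piFinset V ×ˢ V i,
      (Function.update p.1 i p.2, p.1 i) ∈ Fintype.piFinset V ×ˢ V i := by
    intro p hp
    obtain ⟨h1, h2⟩ := Finset.mem_product.1 hp
    rw [Fintype.mem_piFinset] at h1
    refine Finset.mem_product.2 ⟨Fintype.mem_piFinset.2 fun j => ?_, h1 i⟩
    by_cases hj : j = i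
    · subst hj; simpa using h2
    · simpa [hj] using h1 j
  refine Finset.sum_nbij' (fun p => (Function.update p.1 i p.2, p.1 i))
    (fun p => (Function.update p.1 i p.2, p.1 i)) key key ?_ ?_ ?_ <;> intro p _ <;> simp

theorem aux_marg2 {ι : Type} [Fintype ι] [DecidableEq ι] (V : ι → Finset ℕ) (i j : ι)
    (hij : i ≠ j) (p : ℕ → ℕ → Prop) :
    (((V i).card : ℝ) * (V j).card) * ∑ ω ∈ Fintype.piFinset V, (if p (ω i) (ω j) then (1:ℝ) else 0)
      = (Fintype.piFinset V).card * (((V i ×ˢ V j).filter fun q => p q.1 q.2).card : ℝ) := by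
  rw [mul_assoc, aux_avg V j, aux_avg V i]
  simp only [Function.update_self, Function.update_of_ne hij, Finset.sum_const, nsmul_eq_mul]
  rw [Finset.card_filter, Finset.sum_product]
  push_cast
  rfl

theorem aux_marg3 {ι : Type} [Fintype ι] [DecidableEq ι] (V : ι → Finset ℕ) (i j k : ι)
    (hij : i ≠ j) (hik : i ≠ k) (hjk : j ≠ k) (p : ℕ → ℕ → ℕ → Prop) :
    (((V i).card : ℝ) * (V j).card * (V k).card) *
        ∑ ω ∈ Fintype.piFinset V, (if p (ω i) (ω j) (ω k) then (1:ℝ) else 0)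
      = (Fintype.piFinset V).card *
        (((V i ×ˢ V j ×ˢ V k).filter fun q => p q.1 q.2.1 q.2.2).card : ℝ) := by
  rw [mul_assoc, mul_assoc, aux_avg V k, aux_avg V j, aux_avg V i]
  simp only [Function.update_self, Function.update_of_ne hij, Function.update_of_ne hik,
    Function.update_of_ne hjk, Finset.sum_const, nsmul_eq_mul]
  rw [Finset.card_filter, Finset.sum_product]
  push_cast
  congr 1
  refine Finset.sum_congr rfl fun a _ => ?_
  rw [Finset.sum_product]

theorem aux_prob {ι κ : Type} [Fintype ι] [DecidableEq ι] (V : ι → Finset ℕ)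
    (hV : ∀ i, (V i).Nonempty) (bad : ι → ι → ℕ → ℕ → Prop) (η δ : ℝ) (hδ : 0 < δ)
    (hbad : ∀ i j, i ≠ j → (((V i ×ˢ V j).filter fun q => bad i j q.1 q.2).card : ℝ)
      ≤ η * ((V i).card * (V j).card))
    (G : Finset κ) (hG : G.Nonempty) (u v w : κ → ι) (huv : ∀ g, u g ≠ v g)
    (huw : ∀ g, u g ≠ w g) (hvw : ∀ g, v g ≠ w g) (good : κ → ℕ → ℕ → ℕ → Prop)
    (hgood : ∀ g ∈ G, δ * ((V (u g)).card * (V (v g)).card * (V (w g)).card) ≤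
      (((V (u g) ×ˢ V (v g) ×ˢ V (w g)).filter fun q => good g q.1 q.2.1 q.2.2).card : ℝ))
    (hη0 : 0 ≤ η) (hη : η * (Fintype.card ι : ℝ) ^ 2 ≤ δ / 2) :
    ∃ ω : ι → ℕ, (∀ i, ω i ∈ V i) ∧ (∀ i j, i ≠ j → ¬ bad i j (ω i) (ω j)) ∧
      δ / 2 * (G.card : ℝ) ≤ ((G.filter fun g => good g (ω (u g)) (ω (v g)) (ω (w g))).card : ℝ) := by
  have hpos : ∀ i, (0:ℝ) < (V i).card := fun i => by exact_mod_cast (hV i).card_pos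
  set Ω := Fintype.piFinset V with hΩ
  have hΩne : Ω.Nonempty := Fintype.piFinset_nonempty.2 hV
  have hΩpos : (0:ℝ) < Ω.card := by exact_mod_cast hΩne.card_pos
  let gd : (ι → ℕ) → ℝ := fun ω => ∑ g ∈ G, if good g (ω (u g)) (ω (v g)) (ω (w g)) then (1:ℝ) else 0
  let bd : (ι → ℕ) → ℝ := fun ω => ∑ i, ∑ j, if i ≠ j ∧ bad i j (ω i) (ω j) then (1:ℝ) else 0
  have h1 : δ * G.card * Ω.card ≤ ∑ ω ∈ Ω, gd ω := by
    simp only [gd]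
    rw [Finset.sum_comm]
    have : ∀ g ∈ G, δ * Ω.card ≤
        ∑ ω ∈ Ω, if good g (ω (u g)) (ω (v g)) (ω (w g)) then (1:ℝ) else 0 := by
      intro g hg
      have hm := aux_marg3 V (u g) (v g) (w g) (huv g) (huw g) (hvw g) (good g)
      have hp : 0 < ((V (u g)).card : ℝ) * (V (v g)).card * (V (w g)).card :=
        mul_pos (mul_pos (hpos _) (hpos _)) (hpos _)
      have := mul_le_mul_of_nonneg_left (hgood g hg) hΩpos.le
      rw [← hm] at this
      refine le_of_mul_le_mul_left ?_ hp
      linarith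
    calc δ * G.card * Ω.card = ∑ g ∈ G, δ * Ω.card := by simp; ring
      _ ≤ _ := Finset.sum_le_sum this
  have h2 : ∑ ω ∈ Ω, bd ω ≤ η * (Fintype.card ι : ℝ) ^ 2 * Ω.card := by
    simp only [bd]
    rw [Finset.sum_comm]
    have : ∀ i j, ∑ ω ∈ Ω, (if i ≠ j ∧ bad i j (ω i) (ω j) then (1:ℝ) else 0) ≤ η * Ω.card := by
      intro i j
      by_cases hij : i = j
      · simp [hij]; positivity
      · simp only [ne_eq, hij, not_false_eq_true, true_and]
        have hm := aux_marg2 V i j hij (bad i j)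
        have hp : 0 < ((V i).card : ℝ) * (V j).card := mul_pos (hpos _) (hpos _)
        have := mul_le_mul_of_nonneg_left (hbad i j hij) hΩpos.le
        rw [← hm] at this
        refine le_of_mul_le_mul_left ?_ hp
        linarith
    calc _ = ∑ i, ∑ j, ∑ ω ∈ Ω, (if i ≠ j ∧ bad i j (ω i) (ω j) then (1:ℝ) else 0) :=
          Finset.sum_congr rfl fun i _ => Finset.sum_comm
      _ ≤ ∑ i : ι, ∑ j : ι, η * Ω.card :=
          Finset.sum_le_sum fun i _ => Finset.sum_le_sum fun j _ => this i j
      _ = _ := by simp; ring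
  have h3 : ∑ ω ∈ Ω, (δ / 2 * G.card) ≤ ∑ ω ∈ Ω, (gd ω - G.card * bd ω) := by
    rw [Finset.sum_sub_distrib, Finset.sum_const, nsmul_eq_mul, ← Finset.mul_sum]
    have h4 := mul_le_mul_of_nonneg_right hη hΩpos.le
    have h5 := mul_le_mul_of_nonneg_left (h2.trans h4) (Nat.cast_nonneg (α := ℝ) G.card)
    linarith
  obtain ⟨ω, hω, hle⟩ := Finset.exists_le_of_sum_le hΩne h3
  have hGpos : (0:ℝ) < G.card := by exact_mod_cast hG.card_pos
  have hgdle : gd ω ≤ G.card := by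
    simp only [gd]
    calc _ ≤ ∑ g ∈ G, (1:ℝ) := Finset.sum_le_sum fun g _ => by split_ifs <;> norm_num
      _ = _ := by simp
  have hnn : ∀ i j, (0:ℝ) ≤ if i ≠ j ∧ bad i j (ω i) (ω j) then (1:ℝ) else 0 := fun i j => by
    split_ifs <;> norm_num
  have hbd0 : 0 ≤ bd ω := Finset.sum_nonneg fun i _ => Finset.sum_nonneg fun j _ => hnn i j
  refine ⟨ω, Fintype.mem_piFinset.1 hω, fun i j hij hb => ?_, ?_⟩
  · have : 1 ≤ bd ω := by
      calc (1:ℝ) = if i ≠ j ∧ bad i j (ω i) (ω j) then (1:ℝ) else 0 := by rw [if_pos ⟨hij, hb⟩]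
        _ ≤ ∑ j, if i ≠ j ∧ bad i j (ω i) (ω j) then (1:ℝ) else 0 :=
          Finset.single_le_sum (f := fun j => if i ≠ j ∧ bad i j (ω i) (ω j) then (1:ℝ) else 0)
            (fun j _ => hnn i j) (Finset.mem_univ j)
        _ ≤ _ := Finset.single_le_sum
            (f := fun i => ∑ j, if i ≠ j ∧ bad i j (ω i) (ω j) then (1:ℝ) else 0)
            (fun i _ => Finset.sum_nonneg fun j _ => hnn i j) (Finset.mem_univ i)
    nlinarith
  · have : (((G.filter fun g => good g (ω (u g)) (ω (v g)) (ω (w g))).card : ℕ) : ℝ) = gd ω := by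
      simp only [gd]
      rw [Finset.card_filter]; push_cast; rfl
    rw [this]
    nlinarith

theorem aux_pick {κ : Type} (T : Finset κ) (ε : ℝ) (hε : 0 < ε) (hT : 1 < ε * T.card)
    (p F N0 : Finset ℕ) (N : κ → Finset ℕ) (hp : p.Nonempty) (hF : F ⊆ p) (hN0 : N0 ⊆ p)
    (hN : ∀ t ∈ T, N t ⊆ p) (cF : (1/3 + ε) * (p.card : ℝ) ≤ F.card)
    (cN0 : (1/3 + ε) * (p.card : ℝ) ≤ N0.card) (cN : ∀ t ∈ T, (1/3 + ε) * (p.card : ℝ) ≤ (N t).card)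
    (dN0 : ((N0 ∩ F).card : ℝ) < ε * p.card) (dN : ∀ t ∈ T, ((N t ∩ F).card : ℝ) < ε * p.card) :
    ∃ t ∈ T, ∃ t' ∈ T, t ≠ t' ∧ ∃ v ∈ p, v ∈ N t ∧ v ∈ N t' ∧ v ∈ N0 := by
  have hp' : (0:ℝ) < p.card := by exact_mod_cast hp.card_pos
  have big : ∀ t ∈ T, ε * p.card ≤ ((N t ∩ N0).card : ℝ) := by
    intro t ht
    have e1 : ((N t ∪ N0).card : ℝ) + (N t ∩ N0).card = (N t).card + N0.card := by
      exact_mod_cast Finset.card_union_add_card_inter _ _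
    have e2 : (((N t ∪ N0) ∪ F).card : ℝ) + ((N t ∪ N0) ∩ F).card = (N t ∪ N0).card + F.card := by
      exact_mod_cast Finset.card_union_add_card_inter _ _
    have e3 : (((N t ∪ N0) ∪ F).card : ℝ) ≤ p.card := by
      exact_mod_cast Finset.card_le_card (Finset.union_subset (Finset.union_subset (hN t ht) hN0) hF)
    have e4 : (((N t ∪ N0) ∩ F).card : ℝ) ≤ (N t ∩ F).card + (N0 ∩ F).card := by
      rw [Finset.union_inter_distrib_right]
      exact_mod_cast Finset.card_union_le _ _
    have := cN t ht
    have := dN t ht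
    linarith
  by_contra hcon
  push Not at hcon
  have hdisj : (T : Set κ).PairwiseDisjoint fun t => N t ∩ N0 := by
    intro t ht t' ht' htt'
    refine Finset.disjoint_left.2 fun v hv hv' => ?_
    rw [Finset.mem_inter] at hv hv'
    exact hcon t ht t' ht' htt' v (hN0 hv.2) hv.1 hv'.1 hv.2
  have h1 := Finset.card_biUnion hdisj
  have h2 : (T.biUnion fun t => N t ∩ N0).card ≤ p.card :=
    Finset.card_le_card (Finset.biUnion_subset.2 fun t _ => Finset.inter_subset_right.trans hN0)
  have h3 : ∑ t ∈ T, ε * (p.card : ℝ) ≤ ∑ t ∈ T, ((N t ∩ N0).card : ℝ) := Finset.sum_le_sum big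
  have h4 : ∑ t ∈ T, ((N t ∩ N0).card : ℝ) ≤ p.card := by
    rw [h1] at h2; exact_mod_cast h2
  rw [Finset.sum_const, nsmul_eq_mul] at h3
  nlinarith

theorem aux_kst (n k m M : ℕ) (c : ℝ) (hk : 0 < k) (S : Finset (Fin n × Fin k))
    (hS : c * n * k ≤ (S.card : ℝ)) (hm : (m : ℝ) ≤ c * k / 2) (hM : (2:ℝ) ^ k * M < c * n / 2) :
    ∃ (X : Finset (Fin n)) (Y : Finset (Fin k)), M ≤ X.card ∧ m ≤ Y.card ∧
      ∀ a ∈ X, ∀ b ∈ Y, (a, b) ∈ S := by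
  let Nb : Fin n → Finset (Fin k) := fun a => Finset.univ.filter fun b => (a, b) ∈ S
  have hcard : (S.card : ℝ) = ∑ a, ((Nb a).card : ℝ) := by
    have : S = (Finset.univ ×ˢ Finset.univ).filter fun q : Fin n × Fin k => q ∈ S := by ext; simp
    rw [this, Finset.card_filter, Finset.sum_product]
    push_cast
    refine Finset.sum_congr rfl fun a _ => ?_
    simp [Nb]
  let H : Finset (Fin n) := Finset.univ.filter fun a => m ≤ (Nb a).card
  have hk' : (0:ℝ) < k := by exact_mod_cast hk
  have hle : ∑ a, ((Nb a).card : ℝ) ≤ ∑ a : Fin n, ((if m ≤ (Nb a).card then (k:ℝ) else 0) + c * k / 2) := by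
    refine Finset.sum_le_sum fun a _ => ?_
    have h0 : (0:ℝ) ≤ c * k / 2 := le_trans (Nat.cast_nonneg m) hm
    split_ifs with h
    · have : ((Nb a).card : ℝ) ≤ k := by
        exact_mod_cast (Finset.card_le_univ (Nb a)).trans (by simp)
      linarith
    · have : ((Nb a).card : ℝ) < m := by exact_mod_cast not_le.1 h
      linarith
  have hH : ∑ a : Fin n, ((if m ≤ (Nb a).card then (k:ℝ) else 0) + c * k / 2) = H.card * k + n * (c * k / 2) := by
    rw [Finset.sum_add_distrib, ← Finset.sum_filter]
    simp [H]
  have hHc : c * n / 2 ≤ (H.card : ℝ) := by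
    rw [hcard] at hS
    rw [hH] at hle
    have : c * n / 2 * k ≤ H.card * k := by linarith
    exact le_of_mul_le_mul_right this hk'
  obtain ⟨Y, X, hXH, hXc, hX⟩ := aux_pigeon H Nb M (by
    have : (2:ℝ) ^ k * M < H.card := lt_of_lt_of_le hM hHc
    rw [Fintype.card_finset, Fintype.card_fin]
    exact_mod_cast this)
  obtain ⟨a, ha⟩ := Finset.card_pos.1 (Nat.zero_lt_of_lt hXc)
  refine ⟨X, Y, hXc.le, ?_, fun a ha b hb => ?_⟩
  · rw [← hX a ha]
    exact (Finset.mem_filter.1 (hXH ha)).2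
  · rw [← hX a ha] at hb
    exact (Finset.mem_filter.1 hb).2

theorem aux_ecount (A : ReducedHG) (X Y Z : Finset ℕ) :
    A.ecount X Y Z = ∑ q ∈ X ×ˢ Y, (Z.filter fun c => A.Edge q.1 q.2 c).card := by
  unfold ReducedHG.ecount
  rw [Finset.card_filter, Finset.sum_product, Finset.sum_product]
  refine Finset.sum_congr rfl fun a _ => ?_
  rw [Finset.sum_product]
  refine Finset.sum_congr rfl fun b _ => ?_
  rw [Finset.card_filter]

theorem aux_bad (A : ReducedHG) (J Φ : Finset ℕ) (μ ε : ℝ) (hε : 0 < ε) (hJ : J ⊆ A.I)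
    (h : A.IsHole μ J Φ)
    (i j k : ℕ) (hi : i ∈ J) (hj : j ∈ J) (hk : k ∈ J) (hij : i ≠ j) (hik : i ≠ k) (hjk : j ≠ k) :
    (((A.P i j ×ˢ A.P i k).filter fun q => q.1 ∈ Φ ∧ q.2 ∈ Φ ∧
      ε * ((A.P j k).card : ℝ) ≤ ((A.nbhd j k q.1 q.2 ∩ (Φ ∩ A.P j k)).card : ℝ)).card : ℝ)
      ≤ μ / ε * ((A.P i j).card * (A.P i k).card) := by
  have hp : (0:ℝ) < (A.P j k).card := by
    exact_mod_cast (A.Pnonempty j k (hJ hj) (hJ hk) hjk).card_pos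
  have h1 := h.2 i hi j hj k hk hij hik hjk
  set B := (A.P i j ×ˢ A.P i k).filter fun q => q.1 ∈ Φ ∧ q.2 ∈ Φ ∧
      ε * ((A.P j k).card : ℝ) ≤ ((A.nbhd j k q.1 q.2 ∩ (Φ ∩ A.P j k)).card : ℝ) with hB
  have h2 : (B.card : ℝ) * (ε * (A.P j k).card) ≤
      (A.ecount (Φ ∩ A.P i j) (Φ ∩ A.P i k) (Φ ∩ A.P j k) : ℝ) := by
    rw [aux_ecount]
    push_cast
    calc (B.card : ℝ) * (ε * (A.P j k).card) = ∑ q ∈ B, (ε * (A.P j k).card) := by simp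
      _ ≤ ∑ q ∈ B, (((Φ ∩ A.P j k).filter fun c => A.Edge q.1 q.2 c).card : ℝ) := by
        refine Finset.sum_le_sum fun q hq => ?_
        refine (Finset.mem_filter.1 hq).2.2.2.trans ?_
        refine Nat.cast_le.2 (Finset.card_le_card fun v hv => ?_)
        simp only [ReducedHG.nbhd, Finset.mem_inter, Finset.mem_filter] at hv ⊢
        tauto
      _ ≤ _ := by
        refine Finset.sum_le_sum_of_subset_of_nonneg (fun q hq => ?_) fun _ _ _ => Nat.cast_nonneg _
        rw [hB, Finset.mem_filter, Finset.mem_product] at hq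
        simp only [Finset.mem_product, Finset.mem_inter]
        tauto
  have h3 : (B.card : ℝ) * ε ≤ μ * ((A.P i j).card * (A.P i k).card) := by
    refine le_of_mul_le_mul_right ?_ hp
    linarith
  rw [div_mul_eq_mul_div, le_div_iff₀ hε]
  exact h3

theorem aux_k5 (A : ReducedHG) (e : Fin 5 → ℕ) (he : Function.Injective e) (hI : ∀ a, e a ∈ A.I)
    (g : Fin 5 → Fin 5 → ℕ) (hg : ∀ a b, a < b → g a b ∈ A.P (e a) (e b))
    (hE : ∀ a b c, a < b → b < c → A.Edge (g a b) (g a c) (g b c)) : A.SupportsK5 := by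
  let f' : Fin 5 → Fin 5 → ℕ := fun a b => if a < b then g a b else g b a
  have f'symm : ∀ a b, f' a b = f' b a := by
    intro a b
    rcases lt_trichotomy a b with h | h | h
    · simp [f', h, h.not_gt]
    · rw [h]
    · simp [f', h, h.not_gt]
  have s1 := A.EdgeSymm
  have s2 := A.EdgeSymm'
  have base : ∀ a b c, a < b → b < c → A.Edge (f' a b) (f' a c) (f' b c) := by
    intro a b c hab hbc
    have := hE a b c hab hbc
    simpa [f', hab, hbc, hab.trans hbc] using this
  have all : ∀ a b c, a ≠ b → a ≠ c → b ≠ c → A.Edge (f' a b) (f' a c) (f' b c) := by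
    intro a b c hab hac hbc
    rcases lt_or_gt_of_ne hab with h1 | h1 <;> rcases lt_or_gt_of_ne hac with h2 | h2 <;>
      rcases lt_or_gt_of_ne hbc with h3 | h3
    · exact base a b c h1 h3
    · rw [f'symm b c]; exact s1 _ _ _ (base a c b h2 h3)
    · exact absurd (h1.trans h3) h2.not_gt
    · rw [f'symm a c, f'symm b c]; exact s1 _ _ _ (s2 _ _ _ (base c a b h2 h1))
    · rw [f'symm a b]; exact s2 _ _ _ (base b a c h1 h2)
    · exact absurd (h2.trans h3) h1.not_gt
    · rw [f'symm a b, f'symm a c]; exact s2 _ _ _ (s1 _ _ _ (base b c a h3 h2))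
    · rw [f'symm a b, f'symm a c, f'symm b c]
      exact s2 _ _ _ (s1 _ _ _ (s2 _ _ _ (base c b a h3 h1)))
  have inv : ∀ a, Function.invFun e (e a) = a := Function.leftInverse_invFun he
  refine ⟨Finset.univ.image e, ?_, ?_, fun i j => f' (Function.invFun e i) (Function.invFun e j), ?_, ?_, ?_⟩
  · intro i hi
    obtain ⟨a, -, rfl⟩ := Finset.mem_image.1 hi
    exact hI a
  · rw [Finset.card_image_of_injective _ he]; simp
  · intro i _ j _
    exact f'symm _ _
  · intro i hi j hj hij
    obtain ⟨a, -, rfl⟩ := Finset.mem_image.1 hi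
    obtain ⟨b, -, rfl⟩ := Finset.mem_image.1 hj
    simp only [inv]
    have hab : a ≠ b := fun h => hij (by rw [h])
    rcases lt_or_gt_of_ne hab with h | h
    · simpa [f', h] using hg a b h
    · rw [A.Psymm]; simpa [f', h, h.not_gt] using hg b a h
  · intro i hi j hj k hk hij hik hjk
    obtain ⟨a, -, rfl⟩ := Finset.mem_image.1 hi
    obtain ⟨b, -, rfl⟩ := Finset.mem_image.1 hj
    obtain ⟨c, -, rfl⟩ := Finset.mem_image.1 hk
    simp only [inv]
    exact all a b c (fun h => hij (by rw [h])) (fun h => hik (by rw [h])) (fun h => hjk (by rw [h]))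

theorem aux_k5' (A : ReducedHG) (x x' y y' z v q1 q2 q3 q4 r r' w s s' : ℕ)
    (hx : x ∈ A.I) (hx' : x' ∈ A.I) (hy : y ∈ A.I) (hy' : y' ∈ A.I) (hz : z ∈ A.I)
    (n1 : x ≠ x') (n2 : x ≠ y) (n3 : x ≠ y') (n4 : x ≠ z) (n5 : x' ≠ y) (n6 : x' ≠ y') (n7 : x' ≠ z)
    (n8 : y ≠ y') (n9 : y ≠ z) (n10 : y' ≠ z)
    (p1 : v ∈ A.P x x') (p2 : q1 ∈ A.P x y) (p3 : q2 ∈ A.P x y') (p4 : r ∈ A.P x z)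
    (p5 : q3 ∈ A.P x' y) (p6 : q4 ∈ A.P x' y') (p7 : r' ∈ A.P x' z)
    (p8 : w ∈ A.P y y') (p9 : s ∈ A.P y z) (p10 : s' ∈ A.P y' z)
    (e1 : A.Edge q1 q3 v) (e2 : A.Edge q2 q4 v) (e3 : A.Edge r r' v)
    (e4 : A.Edge q1 q2 w) (e5 : A.Edge q3 q4 w) (e6 : A.Edge s s' w)
    (e7 : A.Edge q1 r s) (e8 : A.Edge q2 r s') (e9 : A.Edge q3 r' s) (e10 : A.Edge q4 r' s') :
    A.SupportsK5 := by
  have rot : ∀ a b c, A.Edge a b c → A.Edge c a b := fun a b c h => A.EdgeSymm _ _ _ (A.EdgeSymm' _ _ _ h)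
  refine aux_k5 A ![x, x', y, y', z] ?_ ?_
    ![![0, v, q1, q2, r], ![0, 0, q3, q4, r'], ![0, 0, 0, w, s], ![0, 0, 0, 0, s'], ![0, 0, 0, 0, 0]] ?_ ?_
  · intro a b
    fin_cases a <;> fin_cases b <;> simp [*, Ne.symm n1, Ne.symm n2, Ne.symm n3, Ne.symm n4, Ne.symm n5, Ne.symm n6, Ne.symm n7, Ne.symm n8, Ne.symm n9, Ne.symm n10]
  · intro a
    fin_cases a <;> simpa
  · intro a b hab
    fin_cases a <;> fin_cases b <;> first | exact absurd hab (by decide) | simpa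
  · intro a b c hab hbc
    have e1' := rot _ _ _ e1
    have e2' := rot _ _ _ e2
    have e3' := rot _ _ _ e3
    have e6' := e6
    fin_cases a <;> fin_cases b <;> first | exact absurd hab (by decide) | (fin_cases c <;> first | exact absurd hbc (by decide) | assumption | exact rot _ _ _ (by assumption))

/-- the bad cherries -/
def auxB (A : ReducedHG) (ε : ℝ) (Φ : Finset ℕ) (i j k a b : ℕ) : Prop :=
  a ∈ A.P i j ∧ b ∈ A.P i k ∧ a ∈ Φ ∧ b ∈ Φ ∧
    ε * ((A.P j k).card : ℝ) ≤ ((A.nbhd j k a b ∩ (Φ ∩ A.P j k)).card : ℝ)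

theorem aux_bad' (A : ReducedHG) (J Φ : Finset ℕ) (μ ε : ℝ) (hε : 0 < ε) (hJ : J ⊆ A.I)
    (h : A.IsHole μ J Φ)
    (i j k : ℕ) (hi : i ∈ J) (hj : j ∈ J) (hk : k ∈ J) (hij : i ≠ j) (hik : i ≠ k) (hjk : j ≠ k)
    (U V : Finset ℕ) (hU : U = A.P i j) (hV : V = A.P i k) (pr : ℕ → ℕ → Prop)
    (hpr : ∀ a b, pr a b → auxB A ε Φ i j k a b) :
    (((U ×ˢ V).filter fun q => pr q.1 q.2).card : ℝ) ≤ μ / ε * (U.card * V.card) := by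
  subst hU hV
  refine le_trans (Nat.cast_le.2 (Finset.card_le_card ?_)) (aux_bad A J Φ μ ε hε hJ h i j k hi hj hk hij hik hjk)
  intro q hq
  rw [Finset.mem_filter] at hq ⊢
  exact ⟨hq.1, (hpr _ _ hq.2).2.2⟩

/-- the bad event for a pair of coordinates -/
def auxBad (A : ReducedHG) (ε : ℝ) (Φ Ψ : Finset ℕ) {n k : ℕ} (x : Fin n → ℕ) (y : Fin k → ℕ) (z : ℕ) :
    ((Fin n × Fin k) ⊕ (Fin n ⊕ Fin k)) → ((Fin n × Fin k) ⊕ (Fin n ⊕ Fin k)) → ℕ → ℕ → Prop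
  | .inl (a, b), .inl (a', b'), u, v =>
    if b = b' then auxB A ε Φ (y b) (x a) (x a') u v else
      (a = a' ∧ auxB A ε Ψ (x a) (y b) (y b') u v)
  | .inr (.inl a), .inr (.inl a'), u, v => auxB A ε Φ z (x a) (x a') u v
  | .inr (.inr b), .inr (.inr b'), u, v => auxB A ε Ψ z (y b) (y b') u v
  | _, _, _, _ => False

/-- vertex classes of the coordinates -/
def auxV (A : ReducedHG) {n k : ℕ} (x : Fin n → ℕ) (y : Fin k → ℕ) (z : ℕ) :
    ((Fin n × Fin k) ⊕ (Fin n ⊕ Fin k)) → Finset ℕ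
  | .inl (a, b) => A.P (x a) (y b)
  | .inr (.inl a) => A.P (x a) z
  | .inr (.inr b) => A.P (y b) z

theorem aux_badcount (A : ReducedHG) (J Φ Ψ : Finset ℕ) (μ ε : ℝ) (hε : 0 < ε) (hμ : 0 < μ) (hJ : J ⊆ A.I)
    (hΦ : A.IsHole μ J Φ) (hΨ : A.IsHole μ J Ψ) {n k : ℕ} (x : Fin n → ℕ) (y : Fin k → ℕ) (z : ℕ)
    (hx : ∀ a, x a ∈ J) (hy : ∀ b, y b ∈ J) (hz : z ∈ J) (ix : Function.Injective x)
    (iy : Function.Injective y) (xy : ∀ a b, x a ≠ y b) (xz : ∀ a, x a ≠ z) (yz : ∀ b, y b ≠ z)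
    (i j : (Fin n × Fin k) ⊕ (Fin n ⊕ Fin k)) (hij : i ≠ j) :
    (((auxV A x y z i ×ˢ auxV A x y z j).filter fun q => auxBad A ε Φ Ψ x y z i j q.1 q.2).card : ℝ)
      ≤ μ / ε * ((auxV A x y z i).card * (auxV A x y z j).card) := by
  have triv : ∀ U V : Finset ℕ, ∀ pr : ℕ → ℕ → Prop, (∀ a b, ¬ pr a b) →
      (((U ×ˢ V).filter fun q => pr q.1 q.2).card : ℝ) ≤ μ / ε * (U.card * V.card) := by
    intro U V pr h
    rw [Finset.filter_false_of_mem (fun q _ => h _ _)]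
    simp only [Finset.card_empty, Nat.cast_zero]
    positivity
  rcases i with ⟨a, b⟩ | a | b <;> rcases j with ⟨a', b'⟩ | a' | b'
  · by_cases hb : b = b'
    · subst hb
      have haa : a ≠ a' := fun h => hij (by rw [h])
      exact aux_bad' A J Φ μ ε hε hJ hΦ (y b) (x a) (x a') (hy _) (hx _) (hx _) (xy _ _).symm
        (xy _ _).symm (fun h => haa (ix h)) _ _ (A.Psymm _ _) (A.Psymm _ _) _
        (fun u v h => by simpa [auxBad] using h)
    · by_cases ha : a = a'
      · subst ha
        exact aux_bad' A J Ψ μ ε hε hJ hΨ (x a) (y b) (y b') (hx _) (hy _) (hy _) (xy _ _)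
          (xy _ _) (fun h => hb (iy h)) _ _ rfl rfl _
          (fun u v h => by simpa [auxBad, hb] using h)
      · exact triv _ _ _ (fun u v h => by simp [auxBad, hb, ha] at h)
  · exact triv _ _ _ (fun u v h => by simp [auxBad] at h)
  · exact triv _ _ _ (fun u v h => by simp [auxBad] at h)
  · exact triv _ _ _ (fun u v h => by simp [auxBad] at h)
  · have haa : a ≠ a' := fun h => hij (by rw [h])
    exact aux_bad' A J Φ μ ε hε hJ hΦ z (x a) (x a') hz (hx _) (hx _) (xz _).symm
        (xz _).symm (fun h => haa (ix h)) _ _ (A.Psymm _ _) (A.Psymm _ _) _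
        (fun u v h => by simpa [auxBad] using h)
  · exact triv _ _ _ (fun u v h => by simp [auxBad] at h)
  · exact triv _ _ _ (fun u v h => by simp [auxBad] at h)
  · exact triv _ _ _ (fun u v h => by simp [auxBad] at h)
  · have haa : b ≠ b' := fun h => hij (by rw [h])
    exact aux_bad' A J Ψ μ ε hε hJ hΨ z (y b) (y b') hz (hy _) (hy _) (yz _).symm
        (yz _).symm (fun h => haa (iy h)) _ _ (A.Psymm _ _) (A.Psymm _ _) _
        (fun u v h => by simpa [auxBad] using h)

theorem aux_main (ε : ℝ) (hε : 0 < ε) (hε1 : ε ≤ 1) : ∃ μ : ℝ, 0 < μ ∧ ∃ n k : ℕ, 0 < n ∧ 0 < k ∧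
    ∀ (A : ReducedHG) (J Φ Ψ : Finset ℕ), A.Wicked ε → J ⊆ A.I →
      A.IsHoleW μ (1/3 + ε) J Φ → A.IsHoleW μ (1/3 + ε) J Ψ →
      ∀ (x : Fin n → ℕ) (y : Fin k → ℕ) (z : ℕ), (∀ a, x a ∈ J) → (∀ b, y b ∈ J) → z ∈ J →
        Function.Injective x → Function.Injective y → (∀ a b, x a ≠ y b) → (∀ a, x a ≠ z) →
        (∀ b, y b ≠ z) → ∀ G : Finset (Fin n × Fin k),
        (∀ g ∈ G, ε ^ 3 * (((A.P (x g.1) (y g.2)).card : ℝ) * (A.P (x g.1) z).card * (A.P (y g.2) z).card)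
          ≤ (A.ecount (Φ ∩ Ψ ∩ A.P (x g.1) (y g.2)) (Φ ∩ A.P (x g.1) z) (Ψ ∩ A.P (y g.2) z) : ℝ)) →
        (G.card : ℝ) < n * k / 2 := by
  obtain ⟨m, hm⟩ := exists_nat_gt (1 / ε)
  have hm1 : 1 < ε * m := by
    rw [div_lt_iff₀ hε] at hm; linarith
  have hm2 : 1 < m := by
    have : (1:ℝ) < m := by nlinarith
    exact_mod_cast this
  set c : ℝ := ε ^ 3 / 4 with hc
  have hc0 : 0 < c := by positivity
  obtain ⟨k, hk⟩ := exists_nat_gt (2 * m / c)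
  have hmk : (m:ℝ) ≤ c * k / 2 := by
    rw [div_lt_iff₀ hc0] at hk; linarith
  have hk0 : 0 < k := by
    rcases Nat.eq_zero_or_pos k with h | h
    · subst h; simp at hmk; omega
    · exact h
  obtain ⟨M, hM⟩ := aux_ramsey (Fin k × Fin k) m
  obtain ⟨n, hn⟩ := exists_nat_gt (2 * ((2:ℝ) ^ k * M) / c)
  have hMn : (2:ℝ) ^ k * M < c * n / 2 := by
    rw [div_lt_iff₀ hc0] at hn; linarith
  have hn0 : 0 < n := by
    rcases Nat.eq_zero_or_pos n with h | h
    · subst h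
      simp only [Nat.cast_zero, mul_zero, zero_div] at hMn
      exact absurd hMn (not_lt.2 (by positivity))
    · exact h
  set d : ℝ := ((Fintype.card ((Fin n × Fin k) ⊕ (Fin n ⊕ Fin k)) : ℕ) : ℝ) with hd
  have hd0 : 0 < d := by
    rw [hd]
    have : 0 < Fintype.card ((Fin n × Fin k) ⊕ (Fin n ⊕ Fin k)) := by
      simp; omega
    exact_mod_cast this
  refine ⟨ε * (ε ^ 3 / 2 / d ^ 2), by positivity, n, k, hn0, hk0, ?_⟩
  intro A J Φ Ψ hA hJ hΦ hΨ x y z hx hy hz ix iy xy xz yz G hG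
  set μ : ℝ := ε * (ε ^ 3 / 2 / d ^ 2) with hμ
  have hμ0 : 0 < μ := by positivity
  by_contra hcon
  push Not at hcon
  have hGne : G.Nonempty := by
    rw [← Finset.card_pos]
    have : (0:ℝ) < n * k / 2 := by
      have : (0:ℝ) < n := by exact_mod_cast hn0
      have : (0:ℝ) < k := by exact_mod_cast hk0
      positivity
    exact_mod_cast lt_of_lt_of_le this hcon
  obtain ⟨ω, hωV, hωb, hωg⟩ := aux_prob (auxV A x y z) (by
      rintro (⟨a, b⟩ | a | b)
      · exact A.Pnonempty _ _ (hJ (hx _)) (hJ (hy _)) (xy _ _)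
      · exact A.Pnonempty _ _ (hJ (hx _)) (hJ hz) (xz _)
      · exact A.Pnonempty _ _ (hJ (hy _)) (hJ hz) (yz _))
    (auxBad A ε Φ Ψ x y z) (μ / ε) (ε ^ 3) (by positivity)
    (aux_badcount A J Φ Ψ μ ε hε hμ0 hJ hΦ.1 hΨ.1 x y z hx hy hz ix iy xy xz yz)
    G hGne (fun g => .inl g) (fun g => .inr (.inl g.1)) (fun g => .inr (.inr g.2))
    (by simp) (by simp) (by simp)
    (fun _ u v w => u ∈ Φ ∧ u ∈ Ψ ∧ v ∈ Φ ∧ w ∈ Ψ ∧ A.Edge u v w)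
    (by
      intro g hg
      refine (hG g hg).trans (Nat.cast_le.2 ?_)
      unfold ReducedHG.ecount
      refine Finset.card_le_card fun q hq => ?_
      simp only [Finset.mem_filter, Finset.mem_product, Finset.mem_inter, auxV] at hq ⊢
      tauto)
    (by positivity)
    (by
      rw [← hd, hμ, mul_div_cancel_left₀ _ hε.ne', div_mul_cancel₀ _ (by positivity)])
  obtain ⟨X, Y, hXM, hYm, hXY⟩ := aux_kst n k m M c hk0 _ (by
    refine le_trans ?_ hωg
    have : c * n * k = ε ^ 3 / 2 * (n * k / 2) := by rw [hc]; ring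
    rw [this]
    exact mul_le_mul_of_nonneg_left hcon (by positivity)) hmk hMn
  let Q : Fin n → Fin k → ℕ := fun a b => ω (.inl (a, b))
  let R : Fin n → ℕ := fun a => ω (.inr (.inl a))
  let S : Fin k → ℕ := fun b => ω (.inr (.inr b))
  have hQ : ∀ a b, Q a b ∈ A.P (x a) (y b) := fun a b => hωV (.inl (a, b))
  have hR : ∀ a, R a ∈ A.P (x a) z := fun a => hωV (.inr (.inl a))
  have hS : ∀ b, S b ∈ A.P (y b) z := fun b => hωV (.inr (.inr b))
  have hQ' : ∀ a b, Q a b ∈ A.P (y b) (x a) := fun a b => by rw [A.Psymm]; exact hQ a b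
  have hR' : ∀ a, R a ∈ A.P z (x a) := fun a => by rw [A.Psymm]; exact hR a
  have hS' : ∀ b, S b ∈ A.P z (y b) := fun b => by rw [A.Psymm]; exact hS b
  have hgood : ∀ a ∈ X, ∀ b ∈ Y, Q a b ∈ Φ ∧ Q a b ∈ Ψ ∧ R a ∈ Φ ∧ S b ∈ Ψ ∧
      A.Edge (Q a b) (R a) (S b) := fun a ha b hb =>
    ((@Finset.mem_filter _ _ (_) _ _).1 (hXY a ha b hb)).2
  have bQx : ∀ a a' b, a ≠ a' → ¬ auxB A ε Φ (y b) (x a) (x a') (Q a b) (Q a' b) := by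
    intro a a' b haa h
    exact hωb (.inl (a, b)) (.inl (a', b)) (by simpa using haa) (by simpa [auxBad] using h)
  have bQy : ∀ a b b', b ≠ b' → ¬ auxB A ε Ψ (x a) (y b) (y b') (Q a b) (Q a b') := by
    intro a b b' hbb h
    exact hωb (.inl (a, b)) (.inl (a, b')) (by simpa using hbb) (by simpa [auxBad, hbb] using h)
  have bR : ∀ a a', a ≠ a' → ¬ auxB A ε Φ z (x a) (x a') (R a) (R a') := by
    intro a a' haa h
    exact hωb (.inr (.inl a)) (.inr (.inl a')) (by simpa using haa) (by simpa [auxBad] using h)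
  have bS : ∀ b b', b ≠ b' → ¬ auxB A ε Ψ z (y b) (y b') (S b) (S b') := by
    intro b b' hbb h
    exact hωb (.inr (.inr b)) (.inr (.inr b')) (by simpa using hbb) (by simpa [auxBad] using h)
  have nb : ∀ Θ i j l u v, ¬ auxB A ε Θ i j l u v → u ∈ A.P i j → v ∈ A.P i l → u ∈ Θ → v ∈ Θ →
      ((A.nbhd j l u v ∩ (Θ ∩ A.P j l)).card : ℝ) < ε * ((A.P j l).card : ℝ) := by
    intro Θ i j l u v h h1 h2 h3 h4
    by_contra h5
    exact h ⟨h1, h2, h3, h4, not_lt.1 h5⟩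
  obtain ⟨hee, hK5⟩ := hA
  have pickX : ∀ a ∈ X, ∀ a' ∈ X, a ≠ a' → ∃ b ∈ Y, ∃ b' ∈ Y, b ≠ b' ∧ ∃ v ∈ A.P (x a) (x a'),
      v ∈ A.nbhd (x a) (x a') (Q a b) (Q a' b) ∧ v ∈ A.nbhd (x a) (x a') (Q a b') (Q a' b') ∧
      v ∈ A.nbhd (x a) (x a') (R a) (R a') := by
    intro a ha a' ha' haa
    have hxx : x a ≠ x a' := fun h => haa (ix h)
    obtain ⟨b0, hb0⟩ := Finset.card_pos.1 (show 0 < Y.card by omega)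
    refine aux_pick Y ε hε ?_ (A.P (x a) (x a')) (Φ ∩ A.P (x a) (x a')) _
      (fun b => A.nbhd (x a) (x a') (Q a b) (Q a' b))
      (A.Pnonempty _ _ (hJ (hx _)) (hJ (hx _)) hxx) Finset.inter_subset_right
      (Finset.filter_subset _ _) (fun b _ => Finset.filter_subset _ _)
      (hΦ.2 _ (hx _) _ (hx _) hxx) ?_ ?_ ?_ ?_
    · have : (m:ℝ) ≤ Y.card := by exact_mod_cast hYm
      nlinarith
    · exact hee _ _ _ (hJ hz) (hJ (hx _)) (hJ (hx _)) (xz _).symm (xz _).symm hxx _ (hR' _) _ (hR' _)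
    · intro b _
      exact hee _ _ _ (hJ (hy b)) (hJ (hx _)) (hJ (hx _)) (xy _ _).symm (xy _ _).symm hxx _ (hQ' _ _) _ (hQ' _ _)
    · exact nb _ _ _ _ _ _ (bR a a' haa) (hR' _) (hR' _) (hgood a ha b0 hb0).2.2.1 (hgood a' ha' b0 hb0).2.2.1
    · intro b hb
      exact nb _ _ _ _ _ _ (bQx a a' b haa) (hQ' _ _) (hQ' _ _) (hgood a ha b hb).1 (hgood a' ha' b hb).1
  have pickY : ∀ X' ⊆ X, X'.card = m → ∀ b ∈ Y, ∀ b' ∈ Y, b ≠ b' → ∃ a ∈ X', ∃ a' ∈ X', a ≠ a' ∧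
      ∃ v ∈ A.P (y b) (y b'),
      v ∈ A.nbhd (y b) (y b') (Q a b) (Q a b') ∧ v ∈ A.nbhd (y b) (y b') (Q a' b) (Q a' b') ∧
      v ∈ A.nbhd (y b) (y b') (S b) (S b') := by
    intro X' hX' hX'c b hb b' hb' hbb
    have hyy : y b ≠ y b' := fun h => hbb (iy h)
    obtain ⟨a0, ha0⟩ := Finset.card_pos.1 (show 0 < X'.card by omega)
    refine aux_pick X' ε hε ?_ (A.P (y b) (y b')) (Ψ ∩ A.P (y b) (y b')) _
      (fun a => A.nbhd (y b) (y b') (Q a b) (Q a b'))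
      (A.Pnonempty _ _ (hJ (hy _)) (hJ (hy _)) hyy) Finset.inter_subset_right
      (Finset.filter_subset _ _) (fun b _ => Finset.filter_subset _ _)
      (hΨ.2 _ (hy _) _ (hy _) hyy) ?_ ?_ ?_ ?_
    · rw [hX'c]; exact hm1
    · exact hee _ _ _ (hJ hz) (hJ (hy _)) (hJ (hy _)) (yz _).symm (yz _).symm hyy _ (hS' _) _ (hS' _)
    · intro a _
      exact hee _ _ _ (hJ (hx a)) (hJ (hy _)) (hJ (hy _)) (xy _ _) (xy _ _) hyy _ (hQ _ _) _ (hQ _ _)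
    · exact nb _ _ _ _ _ _ (bS b b' hbb) (hS' _) (hS' _) (hgood a0 (hX' ha0) b hb).2.2.2.1
        (hgood a0 (hX' ha0) b' hb').2.2.2.1
    · intro a ha
      exact nb _ _ _ _ _ _ (bQy a b b' hbb) (hQ _ _) (hQ _ _) (hgood a (hX' ha) b hb).2.1
        (hgood a (hX' ha) b' hb').2.1
  have colex : ∀ a a', ∃ q : Fin k × Fin k, a ∈ X → a' ∈ X → a ≠ a' → q.1 ∈ Y ∧ q.2 ∈ Y ∧ q.1 ≠ q.2 ∧
      ∃ v ∈ A.P (x a) (x a'),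
      v ∈ A.nbhd (x a) (x a') (Q a q.1) (Q a' q.1) ∧ v ∈ A.nbhd (x a) (x a') (Q a q.2) (Q a' q.2) ∧
      v ∈ A.nbhd (x a) (x a') (R a) (R a') := by
    intro a a'
    by_cases h : a ∈ X ∧ a' ∈ X ∧ a ≠ a'
    · obtain ⟨b, hb, b', hb', h1⟩ := pickX a h.1 a' h.2.1 h.2.2
      exact ⟨(b, b'), fun _ _ _ => ⟨hb, hb', h1⟩⟩
    · exact ⟨(⟨0, hk0⟩, ⟨0, hk0⟩), fun h1 h2 h3 => absurd ⟨h1, h2, h3⟩ h⟩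
  choose col hcol using colex
  obtain ⟨X', hX'X, hX'c, ⟨b, b'⟩, hX'⟩ := hM X col hXM
  have fact : ∀ a ∈ X', ∀ a' ∈ X', a < a' → b ∈ Y ∧ b' ∈ Y ∧ b ≠ b' ∧
      ∃ v ∈ A.P (x a) (x a'),
      v ∈ A.nbhd (x a) (x a') (Q a b) (Q a' b) ∧ v ∈ A.nbhd (x a) (x a') (Q a b') (Q a' b') ∧
      v ∈ A.nbhd (x a) (x a') (R a) (R a') := by
    intro a ha a' ha' haa
    have := hcol a a' (hX'X ha) (hX'X ha') haa.ne
    rw [hX' a ha a' ha' haa] at this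
    exact this
  have hbb : b ∈ Y ∧ b' ∈ Y ∧ b ≠ b' := by
    obtain ⟨a, ha, a', ha', haa⟩ := Finset.one_lt_card.1 (show 1 < X'.card by omega)
    rcases lt_or_gt_of_ne haa with h | h
    · have := fact a ha a' ha' h
      exact ⟨this.1, this.2.1, this.2.2.1⟩
    · have := fact a' ha' a ha h
      exact ⟨this.1, this.2.1, this.2.2.1⟩
  obtain ⟨hb, hb', hbn⟩ := hbb
  have final : ∀ a ∈ X', ∀ a' ∈ X', a < a' → ∀ w ∈ A.P (y b) (y b'),
      w ∈ A.nbhd (y b) (y b') (Q a b) (Q a b') → w ∈ A.nbhd (y b) (y b') (Q a' b) (Q a' b') →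
      w ∈ A.nbhd (y b) (y b') (S b) (S b') → False := by
    intro a ha a' ha' haa w hw w1 w2 w3
    obtain ⟨-, -, -, v, hv, v1, v2, v3⟩ := fact a ha a' ha' haa
    have ed : ∀ {i j u v w}, w ∈ A.nbhd i j u v → A.Edge u v w := fun h => (Finset.mem_filter.1 h).2
    exact hK5 (aux_k5' A (x a) (x a') (y b) (y b') z v (Q a b) (Q a b') (Q a' b) (Q a' b') (R a) (R a')
      w (S b) (S b') (hJ (hx _)) (hJ (hx _)) (hJ (hy _)) (hJ (hy _)) (hJ hz)
      (fun h => haa.ne (ix h)) (xy _ _) (xy _ _) (xz _) (xy _ _) (xy _ _) (xz _)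
      (fun h => hbn (iy h)) (yz _) (yz _) hv (hQ _ _) (hQ _ _) (hR _) (hQ _ _) (hQ _ _) (hR _)
      hw (hS _) (hS _) (ed v1) (ed v2) (ed v3) (ed w1) (ed w2) (ed w3)
      (hgood a (hX'X ha) b hb).2.2.2.2 (hgood a (hX'X ha) b' hb').2.2.2.2
      (hgood a' (hX'X ha') b hb).2.2.2.2 (hgood a' (hX'X ha') b' hb').2.2.2.2)
  obtain ⟨a, ha, a', ha', haa, w, hw, w1, w2, w3⟩ := pickY X' hX'X hX'c b hb b' hb' hbn
  rcases lt_or_gt_of_ne haa with h | h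
  · exact final a ha a' ha' h w hw w1 w2 w3
  · exact final a' ha' a ha h w hw w2 w1 w3

theorem aux_W (A : ReducedHG) (ε : ℝ) (hε : 0 < ε) (hA : A.EEDense (1/3 + ε))
    (Φ1 Φ2 Φ3 : Finset ℕ) (x y z : ℕ) (hx : x ∈ A.I) (hy : y ∈ A.I) (hz : z ∈ A.I)
    (xy : x ≠ y) (xz : x ≠ z) (yz : y ≠ z)
    (h12 : ε * ((A.P x y).card : ℝ) ≤ ((Φ1 ∩ Φ2 ∩ A.P x y).card : ℝ))
    (h23 : ε * ((A.P x z).card : ℝ) ≤ ((Φ2 ∩ Φ3 ∩ A.P x z).card : ℝ))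
    (h13 : ((Φ1 ∩ Φ3 ∩ A.P y z).card : ℝ) < ε * ((A.P y z).card : ℝ))
    (w1 : (1/3 + ε) * ((A.P y z).card : ℝ) ≤ ((Φ1 ∩ A.P y z).card : ℝ))
    (w3 : (1/3 + ε) * ((A.P y z).card : ℝ) ≤ ((Φ3 ∩ A.P y z).card : ℝ)) :
    (ε ^ 3 * (((A.P x y).card : ℝ) * (A.P x z).card * (A.P y z).card)
      ≤ (A.ecount (Φ2 ∩ Φ1 ∩ A.P x y) (Φ2 ∩ A.P x z) (Φ1 ∩ A.P y z) : ℝ)) ∨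
    (ε ^ 3 * (((A.P x z).card : ℝ) * (A.P x y).card * (A.P z y).card)
      ≤ (A.ecount (Φ2 ∩ Φ3 ∩ A.P x z) (Φ2 ∩ A.P x y) (Φ3 ∩ A.P z y) : ℝ)) := by
  set D := Φ1 ∩ Φ2 ∩ A.P x y with hD
  set E := Φ2 ∩ Φ3 ∩ A.P x z with hE
  set p := A.P y z with hp
  have hp0 : (0:ℝ) ≤ p.card := Nat.cast_nonneg _
  have key : ∀ q ∈ D ×ˢ E, 2 * ε * p.card ≤
      (((Φ1 ∩ p).filter fun c => A.Edge q.1 q.2 c).card : ℝ) +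
      (((Φ3 ∩ p).filter fun c => A.Edge q.1 q.2 c).card : ℝ) := by
    intro q hq
    rw [Finset.mem_product] at hq
    have hN := hA x y z hx hy hz xy xz yz q.1 (Finset.mem_inter.1 hq.1).2 q.2 (Finset.mem_inter.1 hq.2).2
    set N := A.nbhd y z q.1 q.2 with hNdef
    have hNp : N ⊆ p := Finset.filter_subset _ _
    have e1 : ((Φ1 ∩ p ∪ Φ3 ∩ p).card : ℝ) + ((Φ1 ∩ p) ∩ (Φ3 ∩ p)).card = (Φ1 ∩ p).card + (Φ3 ∩ p).card := by
      exact_mod_cast Finset.card_union_add_card_inter _ _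
    have e2 : (Φ1 ∩ p) ∩ (Φ3 ∩ p) = Φ1 ∩ Φ3 ∩ p := by
      ext v; simp only [Finset.mem_inter]; tauto
    rw [e2] at e1
    have e3 : ((N ∪ (Φ1 ∩ p ∪ Φ3 ∩ p)).card : ℝ) + (N ∩ (Φ1 ∩ p ∪ Φ3 ∩ p)).card
        = N.card + (Φ1 ∩ p ∪ Φ3 ∩ p).card := by
      exact_mod_cast Finset.card_union_add_card_inter _ _
    have e4 : ((N ∪ (Φ1 ∩ p ∪ Φ3 ∩ p)).card : ℝ) ≤ p.card := by
      exact_mod_cast Finset.card_le_card (Finset.union_subset hNp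
        (Finset.union_subset Finset.inter_subset_right Finset.inter_subset_right))
    have e5 : ((N ∩ (Φ1 ∩ p ∪ Φ3 ∩ p)).card : ℝ) ≤
        (((Φ1 ∩ p).filter fun c => A.Edge q.1 q.2 c).card : ℝ) +
        (((Φ3 ∩ p).filter fun c => A.Edge q.1 q.2 c).card : ℝ) := by
      have : N ∩ (Φ1 ∩ p ∪ Φ3 ∩ p) ⊆ ((Φ1 ∩ p).filter fun c => A.Edge q.1 q.2 c) ∪
          ((Φ3 ∩ p).filter fun c => A.Edge q.1 q.2 c) := by
        intro v hv
        simp only [hNdef, ReducedHG.nbhd, Finset.mem_inter, Finset.mem_union, Finset.mem_filter] at hv ⊢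
        tauto
      exact_mod_cast (Finset.card_le_card this).trans (Finset.card_union_le _ _)
    linarith
  have tot : ((D ×ˢ E).card : ℝ) * (2 * ε * p.card) ≤
      (A.ecount D E (Φ1 ∩ p) : ℝ) + A.ecount D E (Φ3 ∩ p) := by
    rw [aux_ecount, aux_ecount]
    push_cast
    rw [← Finset.sum_add_distrib]
    calc _ = ∑ q ∈ D ×ˢ E, (2 * ε * (p.card : ℝ)) := by rw [Finset.sum_const, nsmul_eq_mul]
      _ ≤ _ := Finset.sum_le_sum key
  have hDE : ε * (A.P x y).card * (ε * (A.P x z).card) ≤ ((D ×ˢ E).card : ℝ) := by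
    rw [Finset.card_product]
    push_cast
    exact mul_le_mul h12 h23 (by positivity) (by positivity)
  have hDE2 := mul_le_mul_of_nonneg_right hDE (show 0 ≤ 2 * ε * (p.card : ℝ) by positivity)
  have m1 : (A.ecount D E (Φ1 ∩ p) : ℝ) ≤ A.ecount (Φ2 ∩ Φ1 ∩ A.P x y) (Φ2 ∩ A.P x z) (Φ1 ∩ p) := by
    unfold ReducedHG.ecount
    refine Nat.cast_le.2 (Finset.card_le_card fun q hq => ?_)
    simp only [hD, hE, Finset.mem_filter, Finset.mem_product, Finset.mem_inter] at hq ⊢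
    tauto
  have m3 : (A.ecount D E (Φ3 ∩ p) : ℝ) ≤ A.ecount (Φ2 ∩ Φ3 ∩ A.P x z) (Φ2 ∩ A.P x y) (Φ3 ∩ A.P z y) := by
    unfold ReducedHG.ecount
    refine Nat.cast_le.2 (Finset.card_le_card_of_injOn (fun q => (q.2.1, q.1, q.2.2)) (fun q hq => ?_) ?_)
    · have hs := A.EdgeSymm q.1 q.2.1 q.2.2
      rw [A.Psymm z y]
      simp only [hD, hE, hp, Finset.coe_filter, Set.mem_setOf_eq, Finset.mem_product, Finset.mem_inter] at hq ⊢
      tauto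
    · rintro ⟨a, b, c⟩ _ ⟨a', b', c'⟩ _ h
      simp only [Prod.mk.injEq] at h ⊢
      tauto
  rw [A.Psymm z y, ← hp] at *
  by_contra hcon
  push Not at hcon
  obtain ⟨c1, c2⟩ := hcon
  have : ε * (A.P x y).card * (ε * (A.P x z).card) * (2 * ε * (p.card : ℝ)) =
    ε ^ 3 * (((A.P x y).card : ℝ) * (A.P x z).card * p.card) +
    ε ^ 3 * (((A.P x z).card : ℝ) * (A.P x y).card * p.card) := by ring
  linarith

theorem aux_trans (ε : ℝ) (hε : 0 < ε) (hε1 : ε ≤ 1) : ∃ μ : ℝ, 0 < μ ∧ ∃ T : ℕ,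
    ∀ (A : ReducedHG) (J Φ1 Φ2 Φ3 : Finset ℕ), A.Wicked ε → J ⊆ A.I → T ≤ J.card →
      A.IsHoleW μ (1/3 + ε) J Φ1 → A.IsHoleW μ (1/3 + ε) J Φ2 → A.IsHoleW μ (1/3 + ε) J Φ3 →
      A.HolesIntersecting ε J Φ1 Φ2 → A.HolesIntersecting ε J Φ2 Φ3 → A.HolesDisjoint ε J Φ1 Φ3 →
      False := by
  obtain ⟨μ, hμ, n, k, hn, hk, H⟩ := aux_main ε hε hε1
  refine ⟨μ, hμ, n + 2 * k, ?_⟩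
  intro A J Φ1 Φ2 Φ3 hA hJ hc h1 h2 h3 h12 h23 h13
  obtain ⟨K, hKJ, hKc⟩ := Finset.exists_subset_card_eq hc
  let e := K.orderEmbOfFin hKc
  have he : ∀ i, e i ∈ J := fun i => hKJ (K.orderEmbOfFin_mem hKc i)
  let x : Fin n → ℕ := fun a => e ⟨a, by omega⟩
  let y : Fin k → ℕ := fun b => e ⟨n + b, by omega⟩
  let z : Fin k → ℕ := fun c => e ⟨n + k + c, by omega⟩
  have ix : Function.Injective x := by
    intro a a' h
    have := e.injective h
    simp only [Fin.mk.injEq] at this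
    exact Fin.ext this
  have iy : Function.Injective y := by
    intro a a' h
    have := e.injective h
    simp only [Fin.mk.injEq] at this
    exact Fin.ext (by omega)
  have iz : Function.Injective z := by
    intro a a' h
    have := e.injective h
    simp only [Fin.mk.injEq] at this
    exact Fin.ext (by omega)
  have xy : ∀ a b, x a ≠ y b := by
    intro a b h
    have := e.injective h
    simp only [Fin.mk.injEq] at this
    omega
  have xz : ∀ a b, x a ≠ z b := by
    intro a b h
    have := e.injective h
    simp only [Fin.mk.injEq] at this
    omega
  have yz : ∀ a b, y a ≠ z b := by
    intro a b h
    have := e.injective h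
    simp only [Fin.mk.injEq] at this
    omega
  let p1 : Fin n → Fin k → Fin k → Prop := fun a b c =>
    ε ^ 3 * (((A.P (x a) (y b)).card : ℝ) * (A.P (x a) (z c)).card * (A.P (y b) (z c)).card)
      ≤ (A.ecount (Φ2 ∩ Φ1 ∩ A.P (x a) (y b)) (Φ2 ∩ A.P (x a) (z c)) (Φ1 ∩ A.P (y b) (z c)) : ℝ)
  let p2 : Fin n → Fin k → Fin k → Prop := fun a b c =>
    ε ^ 3 * (((A.P (x a) (z c)).card : ℝ) * (A.P (x a) (y b)).card * (A.P (z c) (y b)).card)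
      ≤ (A.ecount (Φ2 ∩ Φ3 ∩ A.P (x a) (z c)) (Φ2 ∩ A.P (x a) (y b)) (Φ3 ∩ A.P (z c) (y b)) : ℝ)
  have hor : ∀ a b c, p1 a b c ∨ p2 a b c := by
    intro a b c
    exact aux_W A ε hε hA.1 Φ1 Φ2 Φ3 (x a) (y b) (z c) (hJ (he _)) (hJ (he _)) (hJ (he _))
      (xy _ _) (xz _ _) (yz _ _) (h12 _ (he _) _ (he _) (xy a b)) (h23 _ (he _) _ (he _) (xz a c))
      (h13 _ (he _) _ (he _) (yz b c)) (h1.2 _ (he _) _ (he _) (yz b c)) (h3.2 _ (he _) _ (he _) (yz b c))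
  have c1 : ∀ c, (((Finset.univ : Finset (Fin n × Fin k)).filter fun g => p1 g.1 g.2 c).card : ℝ) < n * k / 2 := by
    intro c
    refine H A J Φ2 Φ1 hA hJ h2 h1 x y (z c) (fun _ => he _) (fun _ => he _) (he _) ix iy xy
      (fun a => xz a c) (fun b => yz b c) _ ?_
    intro g hg
    exact (Finset.mem_filter.1 hg).2
  have c2 : ∀ b, (((Finset.univ : Finset (Fin n × Fin k)).filter fun g => p2 g.1 b g.2).card : ℝ) < n * k / 2 := by
    intro b
    refine H A J Φ2 Φ3 hA hJ h2 h3 x z (y b) (fun _ => he _) (fun _ => he _) (he _) ix iz xz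
      (fun a => xy a b) (fun c => (yz b c).symm) _ ?_
    intro g hg
    exact (Finset.mem_filter.1 hg).2
  have s1 : ∑ c : Fin k, ∑ g : Fin n × Fin k, (if p1 g.1 g.2 c then (1:ℝ) else 0) < ∑ c : Fin k, ((n:ℝ) * k / 2) := by
    refine Finset.sum_lt_sum_of_nonempty ⟨⟨0, hk⟩, Finset.mem_univ _⟩ fun c _ => ?_
    have := c1 c
    rw [Finset.card_filter] at this
    push_cast at this
    exact this
  have s2 : ∑ b : Fin k, ∑ g : Fin n × Fin k, (if p2 g.1 b g.2 then (1:ℝ) else 0) < ∑ c : Fin k, ((n:ℝ) * k / 2) := by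
    refine Finset.sum_lt_sum_of_nonempty ⟨⟨0, hk⟩, Finset.mem_univ _⟩ fun c _ => ?_
    have := c2 c
    rw [Finset.card_filter] at this
    push_cast at this
    exact this
  have r1 : ∑ c : Fin k, ∑ g : Fin n × Fin k, (if p1 g.1 g.2 c then (1:ℝ) else 0) =
      ∑ a : Fin n, ∑ b : Fin k, ∑ c : Fin k, (if p1 a b c then (1:ℝ) else 0) := by
    rw [Finset.sum_comm, Fintype.sum_prod_type]
  have r2 : ∑ b : Fin k, ∑ g : Fin n × Fin k, (if p2 g.1 b g.2 then (1:ℝ) else 0) =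
      ∑ a : Fin n, ∑ b : Fin k, ∑ c : Fin k, (if p2 a b c then (1:ℝ) else 0) := by
    rw [Finset.sum_comm, Fintype.sum_prod_type]
    exact Finset.sum_congr rfl fun a _ => Finset.sum_comm
  have r3 : ∑ a : Fin n, ∑ b : Fin k, ∑ c : Fin k, (1:ℝ) ≤
      ∑ a : Fin n, ∑ b : Fin k, ∑ c : Fin k, (if p1 a b c then (1:ℝ) else 0) +
      ∑ a : Fin n, ∑ b : Fin k, ∑ c : Fin k, (if p2 a b c then (1:ℝ) else 0) := by
    simp only [← Finset.sum_add_distrib]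
    refine Finset.sum_le_sum fun a _ => Finset.sum_le_sum fun b _ => Finset.sum_le_sum fun c _ => ?_
    rcases hor a b c with h | h
    · rw [if_pos h]; split_ifs <;> norm_num
    · rw [if_pos h]; split_ifs <;> norm_num
  rw [r1] at s1
  rw [r2] at s2
  simp only [Finset.sum_const, Finset.card_univ, Fintype.card_fin, nsmul_eq_mul, mul_one] at s1 s2 r3
  nlinarith

end Helpers

/-- Corollary (`cor:equivalent`): given `(μ, 1/3+ε)`-holes `Φ₁, …, Φ_r` in an `ε`-wicked
reduced hypergraph, there is a subset `J⋆` of size `t` on which every pair of the holes is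
either `ε`-intersecting or `ε`-disjoint, and `≡_{ε,J⋆}` is an equivalence relation on the
holes with at most two classes. -/
theorem equivalence_of_holes :
    ∀ ε : ℝ, 0 < ε → ε ≤ 1 → ∃ μ : ℝ, 0 < μ ∧ ∀ t r : ℕ, 2 ≤ t → 2 ≤ r → ∃ s : ℕ,
      ∀ (A : ReducedHG) (J : Finset ℕ), A.Wicked ε → J ⊆ A.I → s ≤ J.card →
        ∀ Φ : Fin r → Finset ℕ,
          (∀ ρ, A.IsHoleW μ (1/3 + ε) J (Φ ρ)) →
          ∃ Js ⊆ J, Js.card = t ∧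
            -- (i) every pair is ε-intersecting or ε-disjoint on J⋆
            (∀ ρ ρ' : Fin r,
              A.HolesIntersecting ε Js (Φ ρ) (Φ ρ') ∨
              A.HolesDisjoint ε Js (Φ ρ) (Φ ρ')) ∧
            -- (ii) ≡_{ε,J⋆} is an equivalence relation with at most two classes
            (∀ ρ : Fin r, A.HolesIntersecting ε Js (Φ ρ) (Φ ρ)) ∧
            (∀ ρ ρ' : Fin r, A.HolesIntersecting ε Js (Φ ρ) (Φ ρ') →
              A.HolesIntersecting ε Js (Φ ρ') (Φ ρ)) ∧
            (∀ ρ ρ' ρ'' : Fin r, A.HolesIntersecting ε Js (Φ ρ) (Φ ρ') →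
              A.HolesIntersecting ε Js (Φ ρ') (Φ ρ'') →
              A.HolesIntersecting ε Js (Φ ρ) (Φ ρ'')) ∧
            (∀ ρ ρ' ρ'' : Fin r,
              A.HolesIntersecting ε Js (Φ ρ) (Φ ρ') ∨
              A.HolesIntersecting ε Js (Φ ρ) (Φ ρ'') ∨
              A.HolesIntersecting ε Js (Φ ρ') (Φ ρ'')) := by
  intro ε hε hε1
  obtain ⟨μ, hμ, T, HT⟩ := aux_trans ε hε hε1
  refine ⟨μ, hμ, fun t r ht hr => ?_⟩
  obtain ⟨s, hs⟩ := aux_ramsey (Fin r → Fin r → Bool) (t + T)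
  refine ⟨s, fun A J hA hJ hsJ Φ hΦ => ?_⟩
  obtain ⟨K, hKJ, hKc, col, hK⟩ := hs J (fun i j ρ ρ' =>
    decide (ε * ((A.P i j).card : ℝ) ≤ ((Φ ρ ∩ Φ ρ' ∩ A.P i j).card : ℝ))) hsJ
  have hK' : ∀ i ∈ K, ∀ j ∈ K, i ≠ j → ∀ ρ ρ',
      (ε * ((A.P i j).card : ℝ) ≤ ((Φ ρ ∩ Φ ρ' ∩ A.P i j).card : ℝ) ↔ col ρ ρ' = true) := by
    intro i hi j hj hij ρ ρ'
    rcases lt_or_gt_of_ne hij with h | h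
    · rw [← hK i hi j hj h, decide_eq_true_iff]
    · rw [← hK j hj i hi h, decide_eq_true_iff, A.Psymm]
  obtain ⟨Js, hJsK, hJsc⟩ := Finset.exists_subset_card_eq (show t ≤ K.card by omega)
  obtain ⟨i₀, hi₀, j₀, hj₀, hij₀⟩ := Finset.one_lt_card.1 (show 1 < Js.card by omega)
  have hint : ∀ L ⊆ K, ∀ ρ ρ', col ρ ρ' = true → A.HolesIntersecting ε L (Φ ρ) (Φ ρ') :=
    fun L hL ρ ρ' h i hi j hj hij => (hK' i (hL hi) j (hL hj) hij ρ ρ').2 h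
  have hdis : ∀ L ⊆ K, ∀ ρ ρ', ¬ col ρ ρ' = true → A.HolesDisjoint ε L (Φ ρ) (Φ ρ') :=
    fun L hL ρ ρ' h i hi j hj hij => by
      by_contra h'
      exact h ((hK' i (hL hi) j (hL hj) hij ρ ρ').1 (not_lt.1 h'))
  have hcol : ∀ ρ ρ', A.HolesIntersecting ε Js (Φ ρ) (Φ ρ') → col ρ ρ' = true :=
    fun ρ ρ' h => (hK' i₀ (hJsK hi₀) j₀ (hJsK hj₀) hij₀ ρ ρ').1 (h i₀ hi₀ j₀ hj₀ hij₀)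
  have hhole : ∀ ρ, A.IsHoleW μ (1/3 + ε) K (Φ ρ) := fun ρ =>
    ⟨⟨fun i hi j hj => (hΦ ρ).1.1 i (hKJ hi) j (hKJ hj),
      fun i hi j hj k hk => (hΦ ρ).1.2 i (hKJ hi) j (hKJ hj) k (hKJ hk)⟩,
      fun i hi j hj => (hΦ ρ).2 i (hKJ hi) j (hKJ hj)⟩
  refine ⟨Js, hJsK.trans hKJ, hJsc, ?_, ?_, ?_, ?_, ?_⟩
  · intro ρ ρ'
    by_cases h : col ρ ρ' = true
    · exact Or.inl (hint Js hJsK ρ ρ' h)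
    · exact Or.inr (hdis Js hJsK ρ ρ' h)
  · intro ρ i hi j hj hij
    have h := (hhole ρ).2 i (hJsK hi) j (hJsK hj) hij
    rw [Finset.inter_self]
    have : (0:ℝ) ≤ (A.P i j).card := Nat.cast_nonneg _
    linarith
  · intro ρ ρ' h i hi j hj hij
    rw [Finset.inter_comm (Φ ρ')]
    exact h i hi j hj hij
  · intro ρ ρ' ρ'' h h'
    refine hint Js hJsK ρ ρ'' ?_
    by_contra hcon
    exact HT A K (Φ ρ) (Φ ρ') (Φ ρ'') hA (hKJ.trans hJ) (by omega) (hhole _) (hhole _) (hhole _)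
      (hint K subset_rfl _ _ (hcol _ _ h)) (hint K subset_rfl _ _ (hcol _ _ h'))
      (hdis K subset_rfl _ _ hcon)
  · intro ρ ρ' ρ''
    by_contra hcon
    push Not at hcon
    obtain ⟨c1, c2, c3⟩ := hcon
    have d1 := hdis K subset_rfl ρ ρ' (fun h => c1 (hint Js hJsK _ _ h)) i₀ (hJsK hi₀) j₀ (hJsK hj₀) hij₀
    have d2 := hdis K subset_rfl ρ ρ'' (fun h => c2 (hint Js hJsK _ _ h)) i₀ (hJsK hi₀) j₀ (hJsK hj₀) hij₀
    have d3 := hdis K subset_rfl ρ' ρ'' (fun h => c3 (hint Js hJsK _ _ h)) i₀ (hJsK hi₀) j₀ (hJsK hj₀) hij₀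
    have w1 := (hhole ρ).2 i₀ (hJsK hi₀) j₀ (hJsK hj₀) hij₀
    have w2 := (hhole ρ').2 i₀ (hJsK hi₀) j₀ (hJsK hj₀) hij₀
    have w3 := (hhole ρ'').2 i₀ (hJsK hi₀) j₀ (hJsK hj₀) hij₀
    set p := A.P i₀ j₀ with hp
    have e1 : ((Φ ρ ∩ p ∪ Φ ρ' ∩ p).card : ℝ) + ((Φ ρ ∩ p) ∩ (Φ ρ' ∩ p)).card =
        (Φ ρ ∩ p).card + (Φ ρ' ∩ p).card := by
      exact_mod_cast Finset.card_union_add_card_inter _ _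
    have e2 : ((Φ ρ ∩ p ∪ Φ ρ' ∩ p ∪ Φ ρ'' ∩ p).card : ℝ) + ((Φ ρ ∩ p ∪ Φ ρ' ∩ p) ∩ (Φ ρ'' ∩ p)).card =
        (Φ ρ ∩ p ∪ Φ ρ' ∩ p).card + (Φ ρ'' ∩ p).card := by
      exact_mod_cast Finset.card_union_add_card_inter _ _
    have e3 : ((Φ ρ ∩ p ∪ Φ ρ' ∩ p ∪ Φ ρ'' ∩ p).card : ℝ) ≤ p.card := by
      exact_mod_cast Finset.card_le_card (Finset.union_subset (Finset.union_subset
        Finset.inter_subset_right Finset.inter_subset_right) Finset.inter_subset_right)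
    have e4 : (Φ ρ ∩ p) ∩ (Φ ρ' ∩ p) = Φ ρ ∩ Φ ρ' ∩ p := by
      ext v; simp only [Finset.mem_inter]; tauto
    have e5 : (((Φ ρ ∩ p ∪ Φ ρ' ∩ p) ∩ (Φ ρ'' ∩ p)).card : ℝ) ≤
        (Φ ρ ∩ Φ ρ'' ∩ p).card + (Φ ρ' ∩ Φ ρ'' ∩ p).card := by
      have : (Φ ρ ∩ p ∪ Φ ρ' ∩ p) ∩ (Φ ρ'' ∩ p) ⊆ (Φ ρ ∩ Φ ρ'' ∩ p) ∪ (Φ ρ' ∩ Φ ρ'' ∩ p) := by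
        intro v hv
        simp only [Finset.mem_inter, Finset.mem_union] at hv ⊢
        tauto
      exact_mod_cast (Finset.card_le_card this).trans (Finset.card_union_le _ _)
    rw [e4] at e1
    linarith
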